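/- Let k ≥ 3, n ≥ 1, let c₀ be a stable configuration on P_n^k, and let c be the last configuration of a legal firing sequence starting from c₀ in which the bank vertex 0 is fired exactly once (at the first step). Then ω(c) ≥ ω(c₀), where ω(c) = ∑_{v=1}^{n(k−1)} c(v); moreover ω(c) = ω(c₀) if and only if each of the vertices 1, …, k−1 is fired on the edge e₁ exactly once during the sequence. -/

import Mathlib

open Finset

/-- Vertex `v` belongs to the edge `e_t = {(t-1)(k-1), …, t(k-1)}` of the
hyperpath `P_n^k`. -/
def inEdge (k t v : ℕ) : Prop := (t - 1) * (k - 1) ≤ v ∧ v ≤ t * (k - 1)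

instance (k t v : ℕ) : Decidable (inEdge k t v) :=
  inferInstanceAs (Decidable (_ ∧ _))

/-- Firing the vertex `u` on the edge `e_t` of `P_n^k`: `u` loses `k-1` dollars
and every other vertex of `e_t` gains one dollar. -/
def fireStep (k t u : ℕ) (c : ℕ → ℤ) : ℕ → ℤ := fun v =>
  if v = u then c u - ((k : ℤ) - 1)
  else if inEdge k t v then c v + 1
  else c v

/-- A configuration on `P_n^k` (bank vertex `0`) is stable: at every vertex
`v ≠ 0` its value lies in `{0, …, k-2}`. -/
def StableConf (k n : ℕ) (c : ℕ → ℤ) : Prop :=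
  ∀ v, 1 ≤ v → v ≤ n * (k - 1) → 0 ≤ c v ∧ c v ≤ (k : ℤ) - 2

/-- A legal firing sequence on the hyperpath `P_n^k` with bank vertex `0`,
starting from a stable configuration `conf 0`, in which the bank is fired
exactly once, at the first step (on the edge `e₁`).  At every later step the
fired vertex is the largest vertex `v ≠ 0` whose value is `≥ k-1`, fired on
some edge containing it. -/
structure FiringSeq (k n : ℕ) where
  /-- the number of firing steps -/
  len : ℕ
  /-- the configurations `conf 0, conf 1, …, conf len` -/
  conf : ℕ → ℕ → ℤ
  /-- the vertex fired at step `j` (for `j < len`) -/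
  vert : ℕ → ℕ
  /-- the index of the edge on which step `j` fires (for `j < len`) -/
  edg : ℕ → ℕ
  one_le_len : 1 ≤ len
  start_stable : StableConf k n (conf 0)
  edg_mem : ∀ j < len, 1 ≤ edg j ∧ edg j ≤ n
  vert_mem : ∀ j < len, inEdge k (edg j) (vert j)
  conf_step : ∀ j < len, conf (j + 1) = fireStep k (edg j) (vert j) (conf j)
  first_vert : vert 0 = 0
  first_edg : edg 0 = 1
  bank_once : ∀ j, 1 ≤ j → j < len → vert j ≠ 0
  fire_legal : ∀ j, 1 ≤ j → j < len →
    (k : ℤ) - 1 ≤ conf j (vert j) ∧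
    ∀ v, vert j < v → v ≤ n * (k - 1) → conf j v < (k : ℤ) - 1

/-- The weight of a configuration: the sum of its values at the non-bank
vertices `1, …, n(k-1)`. -/
def wtConf (k n : ℕ) (c : ℕ → ℤ) : ℤ := ∑ v ∈ Finset.Icc 1 (n * (k - 1)), c v

namespace FiringSeq

variable {k n : ℕ} (S : FiringSeq k n)

/-- The amount received by the vertex `v` at step `i` through the edge `e_t`, assuming `v ∈ e_t`. -/
def gain (t v i : ℕ) : ℤ :=
  if S.edg i = t then (if S.vert i = v then 1 - (k : ℤ) else 1) else 0

/-- The amount received by the vertex `v` through the edge `e_t` during the steps `s ≤ i < j`. -/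
def netGain (t v s j : ℕ) : ℤ := ∑ i ∈ Ico s j, S.gain t v i

/-- The number of times `v` is fired on `e_t` during the steps `s ≤ i < j`. -/
def fireCount (t v s j : ℕ) : ℕ :=
  ((Ico s j).filter (fun i => S.vert i = v ∧ S.edg i = t)).card

/-- All vertices beyond `a` have value at most `k - 2` at time `s`. -/
def StableBeyond (a s : ℕ) : Prop :=
  ∀ v, a < v → v ≤ n * (k - 1) → S.conf s v ≤ (k : ℤ) - 2

lemma stableBeyond_vert {j : ℕ} (hj : j < S.len) : S.StableBeyond (S.vert j) j := by
  intro v hv hvn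
  rcases Nat.eq_zero_or_pos j with rfl | h
  · exact (S.start_stable v (by omega) hvn).2
  · have := (S.fire_legal j h hj).2 v hv hvn
    omega

lemma le_conf_vert {j : ℕ} (hj : j < S.len) (h0 : S.vert j ≠ 0) :
    (k : ℤ) - 1 ≤ S.conf j (S.vert j) := by
  rcases Nat.eq_zero_or_pos j with rfl | h
  · exact absurd S.first_vert h0
  · exact (S.fire_legal j h hj).1

lemma fireCount_succ (t v : ℕ) {s j : ℕ} (h : s ≤ j) :
    S.fireCount t v s (j + 1) =
      S.fireCount t v s j + if S.vert j = v ∧ S.edg j = t then 1 else 0 := by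
  unfold fireCount
  rw [card_filter, card_filter, sum_Ico_succ_top h]

/-- An edge containing a vertex `v` with `r(k-1) < v ≤ (r+1)(k-1)` is `e_{r+1}`, or
`e_{r+2}` if `v` is the last vertex of `e_{r+1}`. -/
lemma edge_cases {r t v : ℕ} (ht : 1 ≤ t) (h1 : r * (k - 1) < v)
    (h2 : v ≤ (r + 1) * (k - 1)) (h : inEdge k t v) :
    t = r + 1 ∨ (t = r + 2 ∧ v = (r + 1) * (k - 1)) := by
  obtain ⟨ha, hb⟩ := h
  obtain ⟨q, rfl⟩ : ∃ q, t = q + 1 := ⟨t - 1, by omega⟩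
  rw [Nat.add_sub_cancel] at ha
  have hr : r < q + 1 := lt_of_mul_lt_mul_right (h1.trans_le hb) (Nat.zero_le _)
  have hK : 0 < k - 1 := by
    rcases Nat.eq_zero_or_pos (k - 1) with h0 | h0
    · rw [h0] at h1 h2; omega
    · exact h0
  have hq : q ≤ r + 1 := le_of_mul_le_mul_right (ha.trans h2) hK
  rcases (show q = r ∨ q = r + 1 by omega) with rfl | rfl
  · exact Or.inl rfl
  · exact Or.inr ⟨rfl, le_antisymm h2 ha⟩

lemma conf_succ {r v j : ℕ} (hj : j < S.len) (h1 : r * (k - 1) < v)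
    (h2 : v ≤ (r + 1) * (k - 1)) :
    S.conf (j + 1) v = S.conf j v + (S.gain (r + 1) v j +
      if v = (r + 1) * (k - 1) then S.gain (r + 2) v j else 0) := by
  have hin : inEdge k (r + 1) v := ⟨by simpa using h1.le, h2⟩
  have hin2 : v = (r + 1) * (k - 1) → inEdge k (r + 2) v := fun h =>
    ⟨by simp [h], by rw [h]; exact Nat.mul_le_mul_right _ (by omega)⟩
  have hc := fun h => edge_cases (S.edg_mem j hj).1 h1 h2 h
  have hv := S.vert_mem j hj
  rw [S.conf_step j hj]
  unfold fireStep gain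
  grind

lemma conf_eq_add_netGain {r v s j : ℕ} (hs : s ≤ j) (hj : j ≤ S.len) (h1 : r * (k - 1) < v)
    (h2 : v ≤ (r + 1) * (k - 1)) :
    S.conf j v = S.conf s v + (S.netGain (r + 1) v s j +
      if v = (r + 1) * (k - 1) then S.netGain (r + 2) v s j else 0) := by
  induction j, hs using Nat.le_induction with
  | base => simp [netGain]
  | succ j hs ih =>
    rw [S.conf_succ (by omega) h1 h2, ih (by omega)]
    unfold netGain
    rw [sum_Ico_succ_top hs, sum_Ico_succ_top hs]
    split_ifs <;> ring

lemma netGain_eq {r s j : ℕ} (hj : j ≤ S.len) (v : ℕ) :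
    S.netGain (r + 1) v s j =
      ∑ u ∈ Icc (r * (k - 1)) ((r + 1) * (k - 1)), (S.fireCount (r + 1) u s j : ℤ)
        - k * S.fireCount (r + 1) v s j := by
  have hfib : ((Ico s j).filter (fun i => S.edg i = r + 1)).card =
      ∑ u ∈ Icc (r * (k - 1)) ((r + 1) * (k - 1)), S.fireCount (r + 1) u s j := by
    rw [card_eq_sum_card_fiberwise (f := S.vert) (t := Icc (r * (k - 1)) ((r + 1) * (k - 1)))]
    · refine sum_congr rfl fun u _ => ?_
      unfold fireCount
      rw [filter_filter]
      simp only [and_comm]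
    · intro i hi
      simp only [coe_filter, mem_Ico, Set.mem_ofPred_eq] at hi
      have := S.vert_mem i (by omega)
      rw [hi.2] at this
      simpa [inEdge] using this
  have hg : ∀ i, S.gain (r + 1) v i = (if S.edg i = r + 1 then 1 else 0)
      - k * (if S.vert i = v ∧ S.edg i = r + 1 then 1 else 0) := by
    intro i
    unfold gain
    grind
  rw [← Nat.cast_sum, ← hfib]
  unfold netGain fireCount
  simp only [hg, sum_sub_distrib, ← mul_sum, card_filter, Nat.cast_sum, Nat.cast_ite,
    Nat.cast_one, Nat.cast_zero]

lemma netGain_nonpos {r s j v : ℕ} (hk : 1 ≤ k) (hj : j ≤ S.len)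
    (hv : v ∈ Icc (r * (k - 1)) ((r + 1) * (k - 1))) (hpos : 1 ≤ S.fireCount (r + 1) v s j)
    (hle : ∀ u ∈ Icc (r * (k - 1)) ((r + 1) * (k - 1)), u ≠ v → S.fireCount (r + 1) u s j ≤ 1) :
    S.netGain (r + 1) v s j ≤ 0 := by
  rw [S.netGain_eq hj, ← add_sum_erase _ _ hv]
  have hsum : ∑ u ∈ (Icc (r * (k - 1)) ((r + 1) * (k - 1))).erase v,
      (S.fireCount (r + 1) u s j : ℤ) ≤ (k : ℤ) - 1 := by
    refine (sum_le_card_nsmul _ _ 1 fun u hu => ?_).trans ?_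
    · rw [mem_erase] at hu
      exact_mod_cast hle u hu.2 hu.1
    · have : (r + 1) * (k - 1) = r * (k - 1) + (k - 1) := by ring
      rw [card_erase_of_mem hv, Nat.card_Icc]
      simp only [nsmul_eq_mul, mul_one]
      omega
  have hk' : (1 : ℤ) ≤ k := by exact_mod_cast hk
  have hpos' : (1 : ℤ) ≤ S.fireCount (r + 1) v s j := by exact_mod_cast hpos
  nlinarith

/-- During a round following a single firing of `r(k-1)` on `e_{r+1}`, every other vertex of
`e_{r+1}` fires on that edge at most once, provided the part of the path beyond `e_{r+1}`
never returns more than it received. -/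
lemma fireCount_le_one {r s j : ℕ} (hk : 1 ≤ k) (hrn : r < n) (hs : s ≤ j) (hj : j ≤ S.len)
    (hst : S.StableBeyond (r * (k - 1)) s)
    (hret : ∀ i, s ≤ i → i ≤ S.len → S.netGain (r + 2) ((r + 1) * (k - 1)) s i ≤ 0)
    (hbank : S.fireCount (r + 1) (r * (k - 1)) s j ≤ 1) :
    ∀ u ∈ Icc (r * (k - 1)) ((r + 1) * (k - 1)), S.fireCount (r + 1) u s j ≤ 1 := by
  induction j, hs using Nat.le_induction with
  | base => intro u _; simp [fireCount]
  | succ j hs ih =>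
    have hb := hbank
    rw [S.fireCount_succ _ _ hs] at hb
    have ih' := ih (by omega) (by omega)
    intro u hu
    rcases eq_or_ne u (r * (k - 1)) with rfl | hne
    · exact hbank
    rw [S.fireCount_succ _ _ hs]
    have hu1 := ih' u hu
    split_ifs with hfire
    · by_contra hcon
      have hu' := mem_Icc.1 hu
      have hlt : r * (k - 1) < u := by omega
      have hnet := S.netGain_nonpos hk (by omega : j ≤ S.len) hu (by omega)
        (fun w hw _ => ih' w hw)
      have hconf := S.conf_eq_add_netGain hs (by omega) hlt hu'.2
      have hun : u ≤ n * (k - 1) := hu'.2.trans (Nat.mul_le_mul_right _ hrn)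
      have h0 := hst u hlt hun
      have hleg := S.le_conf_vert (j := j) (by omega) (by omega)
      rw [hfire.1] at hleg
      have hr := hret j hs (by omega)
      split_ifs at hconf with huv
      · rw [← huv] at hr; omega
      · omega
    · omega

/-- If the vertices beyond `r(k-1)` are stable and `r(k-1)` is not fired on `e_{r+1}`, then the
edge `e_{r+1}` is not used, and nothing changes beyond `r(k-1)`. -/
lemma edg_le_of_not_fired {r s j : ℕ} (hk : 2 ≤ k) (hs : s ≤ j) (hj : j ≤ S.len)
    (hst : S.StableBeyond (r * (k - 1)) s)
    (hno : ∀ i, s ≤ i → i < j → ¬ (S.vert i = r * (k - 1) ∧ S.edg i = r + 1)) :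
    (∀ i, s ≤ i → i < j → S.edg i ≤ r) ∧ S.StableBeyond (r * (k - 1)) j := by
  induction j, hs using Nat.le_induction with
  | base => exact ⟨fun i h1 h2 => by omega, hst⟩
  | succ j hs ih =>
    obtain ⟨ih1, ih2⟩ := ih (by omega) (fun i h1 h2 => hno i h1 (by omega))
    have hjl : j < S.len := by omega
    have hmem := S.vert_mem j hjl
    have hedg := S.edg_mem j hjl
    have hvn : S.vert j ≤ n * (k - 1) := hmem.2.trans (Nat.mul_le_mul_right _ hedg.2)
    have hvert : S.vert j ≤ r * (k - 1) := by
      by_contra hcon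
      have h1 := ih2 (S.vert j) (by omega) hvn
      have h2 := S.le_conf_vert hjl (by omega)
      omega
    have hle : S.edg j ≤ r := by
      by_contra hcon
      have h1 : r * (k - 1) ≤ (S.edg j - 1) * (k - 1) := Nat.mul_le_mul_right _ (by omega)
      have h2 : (S.edg j - 1) * (k - 1) = r * (k - 1) := le_antisymm (hmem.1.trans hvert) h1
      have h3 := Nat.eq_of_mul_eq_mul_right (by omega) h2
      exact hno j hs (by omega) ⟨le_antisymm hvert (h1.trans hmem.1), by omega⟩
    refine ⟨fun i h1 h2 => ?_, fun v hv hvn => ?_⟩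
    · rcases (show i < j ∨ i = j by omega) with h | rfl
      · exact ih1 i h1 h
      · exact hle
    · have hout : ¬ inEdge k (S.edg j) v := fun h =>
        absurd (h.2.trans (Nat.mul_le_mul_right _ hle)) (by omega)
      rw [S.conf_step j hjl, fireStep, if_neg (by omega), if_neg hout]
      exact ih2 v hv hvn

lemma netGain_eq_zero {t v s j : ℕ} (h : ∀ i, s ≤ i → i < j → S.edg i ≠ t) :
    S.netGain t v s j = 0 :=
  sum_eq_zero fun i hi => if_neg (h i (mem_Ico.1 hi).1 (mem_Ico.1 hi).2)

/-- Starting from a configuration stable beyond `r(k-1)`, the part of the path beyond that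
vertex never returns more to it than it has received from it. -/
lemma netGain_first_vertex_nonpos (hk : 2 ≤ k) (r : ℕ) :
    ∀ s j, s ≤ j → j ≤ S.len → S.StableBeyond (r * (k - 1)) s →
      S.netGain (r + 1) (r * (k - 1)) s j ≤ 0 := by
  induction hd : n - r generalizing r with
  | zero =>
    intro s j _ hj _
    refine (S.netGain_eq_zero fun i _ hi => ?_).le
    have := (S.edg_mem i (by omega)).2
    omega
  | succ d ih =>
    have ih' := ih (r + 1) (by omega)
    intro s j
    induction j using Nat.strong_induction_on with
    | _ j ihj =>
    intro hs hj hst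
    let F := (Ico s j).filter (fun i => S.vert i = r * (k - 1) ∧ S.edg i = r + 1)
    rcases F.eq_empty_or_nonempty with hF | hF
    · have hno := (S.edg_le_of_not_fired hk hs hj hst fun i h1 h2 h3 => by
        have : i ∈ F := mem_filter.2 ⟨mem_Ico.2 ⟨h1, h2⟩, h3⟩
        simp [hF] at this).1
      refine (S.netGain_eq_zero fun i h1 h2 => ?_).le
      have := hno i h1 h2
      omega
    · obtain ⟨m, hm⟩ : ∃ m, m = F.max' hF := ⟨_, rfl⟩
      have hmF : m ∈ F := hm ▸ F.max'_mem hF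
      obtain ⟨hmI, hmv, hme⟩ := mem_filter.1 hmF
      rw [mem_Ico] at hmI
      have hml : m < S.len := by omega
      have hstm : S.StableBeyond (r * (k - 1)) m := hmv ▸ S.stableBeyond_vert hml
      have hcount : S.fireCount (r + 1) (r * (k - 1)) m j = 1 := by
        refine card_eq_one.2 ⟨m, ?_⟩
        ext i
        simp only [mem_filter, mem_Ico, mem_singleton]
        constructor
        · rintro ⟨⟨h1, h2⟩, h3⟩
          have hiF : i ∈ F := mem_filter.2 ⟨mem_Ico.2 ⟨by omega, h2⟩, h3⟩
          have := F.le_max' i hiF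
          omega
        · rintro rfl
          exact ⟨⟨le_rfl, hmI.2⟩, hmv, hme⟩
      have hmono : r * (k - 1) ≤ (r + 1) * (k - 1) := Nat.mul_le_mul_right _ (by omega)
      have hle := S.fireCount_le_one (by omega) (by omega) hmI.2.le hj hstm
        (fun i h1 h2 => ih' m i h1 h2 fun v hv => hstm v (by omega)) hcount.le
      have hlast := S.netGain_nonpos (by omega) hj (mem_Icc.2 ⟨le_rfl, hmono⟩) hcount.ge
        fun u hu _ => hle u hu
      have hprev := ihj m hmI.2 hmI.1 hml.le hst
      have hsplit : S.netGain (r + 1) (r * (k - 1)) s j =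
          S.netGain (r + 1) (r * (k - 1)) s m + S.netGain (r + 1) (r * (k - 1)) m j :=
        (sum_Ico_consecutive _ hmI.1 hmI.2.le).symm
      omega

lemma wtConf_succ (hk : 2 ≤ k) {j : ℕ} (hj : j < S.len) :
    wtConf k n (S.conf (j + 1)) = wtConf k n (S.conf j) - S.gain 1 0 j := by
  have hmem := S.vert_mem j hj
  have hedg := S.edg_mem j hj
  obtain ⟨q, hq⟩ : ∃ q, S.edg j = q + 1 := ⟨S.edg j - 1, by omega⟩
  let δ : ℕ → ℤ := fun v =>
    if v ∈ Icc (q * (k - 1)) ((q + 1) * (k - 1)) then (if v = S.vert j then 1 - (k : ℤ) else 1)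
    else 0
  have hV : S.vert j ∈ Icc (q * (k - 1)) ((q + 1) * (k - 1)) := by
    rw [hq] at hmem
    simpa [inEdge] using hmem
  have hδ : ∀ v, S.conf (j + 1) v = S.conf j v + δ v := by
    intro v
    have hiff : inEdge k (S.edg j) v ↔ v ∈ Icc (q * (k - 1)) ((q + 1) * (k - 1)) := by
      rw [hq]; simp [inEdge]
    rw [S.conf_step j hj]
    simp only [fireStep, hiff, δ]
    grind
  have hsub : Icc (q * (k - 1)) ((q + 1) * (k - 1)) ⊆ Icc 0 (n * (k - 1)) :=
    Icc_subset_Icc (Nat.zero_le _) (Nat.mul_le_mul_right _ (by omega))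
  have htot : ∑ v ∈ Icc 0 (n * (k - 1)), δ v = 0 := by
    rw [← sum_filter, filter_mem_eq_inter, inter_eq_right.2 hsub, ← add_sum_erase _ _ hV,
      if_pos rfl, sum_congr rfl fun v hv => if_neg (mem_erase.1 hv).1, sum_const,
      card_erase_of_mem hV, Nat.card_Icc, add_mul]
    simp only [nsmul_eq_mul, mul_one, one_mul]
    omega
  have hzero : δ 0 = S.gain 1 0 j := by
    have h0 : 0 ∈ Icc (q * (k - 1)) ((q + 1) * (k - 1)) ↔ q = 0 := by
      simp only [mem_Icc, Nat.zero_le, and_true, Nat.le_zero, mul_eq_zero]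
      omega
    simp only [δ, h0, gain, hq, Nat.add_eq_right]
    grind
  rw [← insert_Icc_add_one_left_eq_Icc (Nat.zero_le _), sum_insert (by simp), hzero] at htot
  unfold wtConf
  rw [sum_congr rfl fun v _ => hδ v, sum_add_distrib]
  simp only [zero_add] at htot
  omega

lemma wtConf_eq (hk : 2 ≤ k) {j : ℕ} (hj : j ≤ S.len) :
    wtConf k n (S.conf j) = wtConf k n (S.conf 0) - S.netGain 1 0 0 j := by
  induction j with
  | zero => simp [netGain]
  | succ j ih =>
    rw [S.wtConf_succ hk (by omega), ih (by omega)]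
    unfold netGain
    rw [sum_Ico_succ_top (Nat.zero_le _)]
    ring

lemma fireCount_bank : S.fireCount 1 0 0 S.len = 1 := by
  have hlen := S.one_le_len
  refine card_eq_one.2 ⟨0, ?_⟩
  ext i
  simp only [mem_filter, mem_Ico, mem_singleton]
  constructor
  · rintro ⟨⟨_, h⟩, h0, _⟩
    by_contra hi
    exact S.bank_once i (by omega) h h0
  · rintro rfl
    exact ⟨by omega, S.first_vert, S.first_edg⟩

end FiringSeq

/-- For the final configuration `c` of a legal firing sequence on `P_n^k`
starting from the stable configuration `c₀` (bank fired exactly once, at the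
first step), one has `ω(c) ≥ ω(c₀)`, with equality iff each vertex of
`{1,…,k-1}` is fired on the edge `e₁` exactly once during the sequence. -/
theorem hyperpath_weight_final (k n : ℕ) (hk : 3 ≤ k) (hn : 1 ≤ n)
    (S : FiringSeq k n) :
    wtConf k n (S.conf 0) ≤ wtConf k n (S.conf S.len) ∧
    (wtConf k n (S.conf S.len) = wtConf k n (S.conf 0) ↔
      ∀ v, 1 ≤ v → v ≤ k - 1 →
        ((Finset.range S.len).filter (fun j => S.vert j = v ∧ S.edg j = 1)).card = 1) := by
  have hstable : S.StableBeyond (0 * (k - 1)) 0 := fun v hv hvn =>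
    (S.start_stable v (by omega) hvn).2
  have hle := S.fireCount_le_one (r := 0) (by omega) (by omega) (Nat.zero_le S.len) le_rfl hstable
    (fun i h1 h2 => S.netGain_first_vertex_nonpos (by omega) 1 0 i h1 h2
      fun v hv => hstable v (by omega))
    (by rw [zero_mul]; exact S.fireCount_bank.le)
  simp only [zero_mul, zero_add, one_mul] at hle
  have hle' : ∀ u ∈ Icc 1 (k - 1), (S.fireCount 1 u 0 S.len : ℤ) ≤ 1 := fun u hu => by
    exact_mod_cast hle u (mem_Icc.2 ⟨Nat.zero_le _, (mem_Icc.1 hu).2⟩)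
  have hnet := S.netGain_eq (r := 0) (s := 0) le_rfl 0
  simp only [zero_mul, zero_add, one_mul] at hnet
  rw [← insert_Icc_add_one_left_eq_Icc (Nat.zero_le _), sum_insert (by simp),
    S.fireCount_bank, zero_add] at hnet
  have hwt := S.wtConf_eq (by omega) le_rfl
  have hone : ∑ _u ∈ Icc 1 (k - 1), (1 : ℤ) = (k : ℤ) - 1 := by
    rw [sum_const, Nat.card_Icc]
    simp only [nsmul_eq_mul, mul_one]
    omega
  have hsum := sum_le_sum hle'
  have heq := sum_eq_sum_iff_of_le hle'
  push_cast at hnet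
  refine ⟨by linarith, ?_⟩
  have hiff : wtConf k n (S.conf S.len) = wtConf k n (S.conf 0) ↔
      ∑ u ∈ Icc 1 (k - 1), (S.fireCount 1 u 0 S.len : ℤ) = ∑ _u ∈ Icc 1 (k - 1), (1 : ℤ) := by
    constructor <;> intro h <;> linarith
  rw [hiff, heq, range_eq_Ico]
  simp only [mem_Icc, and_imp, Nat.cast_eq_one, FiringSeq.fireCount]
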